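/- Fix n ∈ ℕ and let (a_N)_{N≥1} be a sequence of positive real numbers with a_N → 0 as N → ∞. Then there exist a constant C > 0 and N₀ ∈ ℕ such that for all N ≥ N₀, |h(n, e^{-a_N/N}, N) − t_n| ≤ C ( a_N/N + a_N² ), where t_0 = 1, t_1 = −a_N, and t_n = 0 for n ≥ 2. -/

import Mathlib

open MeasureTheory Real Filter

noncomputable section

/-- The joint eigenangle density of `SO(2N+1)` on `[0,π]^N`. -/
def densitySO (N : ℕ) (θ : Fin N → ℝ) : ℝ :=
  (2 ^ (N ^ 2) / (π ^ N * N.factorial)) *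
    (∏ j : Fin N, ∏ k ∈ Finset.Ioi j, (Real.cos (θ k) - Real.cos (θ j)) ^ 2) *
    ∏ m : Fin N, Real.sin (θ m / 2) ^ 2

/-- `h(n, s, N)`: the `n`-th moment of the eigenvalue sum against the eigenangle density. -/
def hFun (n : ℕ) (s : ℝ) (N : ℕ) : ℝ :=
  ∫ θ in Set.univ.pi fun _ : Fin N => Set.Icc (0 : ℝ) π,
    ((s - 1) * ∑ j, (2 * s - 2 * Real.cos (θ j)) / (1 + s ^ 2 - 2 * s * Real.cos (θ j))) ^ n *
      densitySO N θ

/-- `g(l, s, N)`: the integral of `∏_j ((1-s)² + 4s sin²(θ_j/2))^{-l_j}` against the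
eigenangle density. -/
def gFun (N : ℕ) (l : Fin N → ℕ) (s : ℝ) : ℝ :=
  ∫ θ in Set.univ.pi fun _ : Fin N => Set.Icc (0 : ℝ) π,
    (∏ j, ((1 - s) ^ 2 + 4 * s * Real.sin (θ j / 2) ^ 2) ^ (-(l j : ℤ))) * densitySO N θ

/-- **Andréief's identity** for the square of an alternant. -/
theorem integral_prod_mul_det_sq {α : Type*} [MeasurableSpace α] (μ : Measure α) [SigmaFinite μ]
    {N : ℕ} (φ : Fin N → α → ℝ) (G : α → ℝ)
    (hint : ∀ i k, Integrable (fun x => G x * (φ i x * φ k x)) μ) :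
    ∫ θ : Fin N → α, (∏ j, G (θ j)) * (Matrix.of fun i j => φ i (θ j)).det ^ 2
        ∂(Measure.pi fun _ => μ) =
      N.factorial * (Matrix.of fun i k => ∫ x, G x * (φ i x * φ k x) ∂μ).det := by
  have hexp : ∀ θ : Fin N → α,
      (∏ j, G (θ j)) * (Matrix.of fun i j => φ i (θ j)).det ^ 2 =
        ∑ σ : Equiv.Perm (Fin N), ∑ τ : Equiv.Perm (Fin N),
          ((Equiv.Perm.sign σ : ℤ) : ℝ) * ((Equiv.Perm.sign τ : ℤ) : ℝ) *
            ∏ j, (G (θ j) * (φ (σ j) (θ j) * φ (τ j) (θ j))) := by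
    intro θ
    rw [sq, Matrix.det_apply', Finset.sum_mul_sum, Finset.mul_sum]
    refine Finset.sum_congr rfl fun σ _ => ?_
    rw [Finset.mul_sum]
    refine Finset.sum_congr rfl fun τ _ => ?_
    simp only [Matrix.of_apply, Finset.prod_mul_distrib]
    ring
  have hprod : ∀ σ τ : Equiv.Perm (Fin N), Integrable (fun θ : Fin N → α =>
      ∏ j, (G (θ j) * (φ (σ j) (θ j) * φ (τ j) (θ j)))) (Measure.pi fun _ => μ) := fun σ τ =>
    Integrable.fintype_prod
      (f := fun j x => G x * (φ (σ j) x * φ (τ j) x)) (fun j => hint (σ j) (τ j))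
  simp_rw [hexp]
  rw [integral_finsetSum _ fun σ _ => integrable_finsetSum _ fun τ _ =>
    (hprod σ τ).const_mul _]
  have hrow : ∀ σ : Equiv.Perm (Fin N),
      ∫ θ : Fin N → α, ∑ τ : Equiv.Perm (Fin N),
          ((Equiv.Perm.sign σ : ℤ) : ℝ) * ((Equiv.Perm.sign τ : ℤ) : ℝ) *
            ∏ j, (G (θ j) * (φ (σ j) (θ j) * φ (τ j) (θ j))) ∂(Measure.pi fun _ => μ) =
        (Matrix.of fun i k => ∫ x, G x * (φ i x * φ k x) ∂μ).det := by
    intro σ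
    rw [integral_finsetSum _ fun τ _ => (hprod σ τ).const_mul _]
    have hperm := Matrix.det_permute σ (Matrix.of fun i k => ∫ x, G x * (φ i x * φ k x) ∂μ)
    have hsq : ((Equiv.Perm.sign σ : ℤ) : ℝ) * ((Equiv.Perm.sign σ : ℤ) : ℝ) = 1 := by
      rcases Int.units_eq_one_or (Equiv.Perm.sign σ) with h | h <;> simp [h]
    rw [← one_mul (Matrix.det _), ← hsq, mul_assoc, ← hperm, ← Matrix.det_transpose,
      Matrix.det_apply', Finset.mul_sum]
    refine Finset.sum_congr rfl fun τ _ => ?_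
    rw [integral_const_mul, mul_assoc,
      integral_fintype_prod_eq_prod (μ := fun _ => μ)
        (fun j x => G x * (φ (σ j) x * φ (τ j) x))]
    simp
  rw [Finset.sum_congr rfl fun σ _ => hrow σ]
  simp [Fintype.card_perm]

/-- The Gram matrix of a family of functions with respect to a nonnegative weight is positive
semidefinite. -/
theorem posSemidef_integral_weight {α : Type*} [MeasurableSpace α] (μ : Measure α)
    {N : ℕ} (φ : Fin N → α → ℝ) (G : α → ℝ) (hG : ∀ x, 0 ≤ G x)
    (hint : ∀ i k, Integrable (fun x => G x * (φ i x * φ k x)) μ) :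
    (Matrix.of fun i k => ∫ x, G x * (φ i x * φ k x) ∂μ).PosSemidef := by
  refine Matrix.PosSemidef.of_dotProduct_mulVec_nonneg ?_ fun v => ?_
  · ext i k
    simp [mul_comm]
  · have : star v ⬝ᵥ (Matrix.of fun i k => ∫ x, G x * (φ i x * φ k x) ∂μ).mulVec v =
        ∫ x, G x * (∑ i, v i * φ i x) ^ 2 ∂μ := by
      have hsq : ∀ x, G x * (∑ i, v i * φ i x) ^ 2 =
          ∑ i, ∑ k, v i * v k * (G x * (φ i x * φ k x)) := by
        intro x
        rw [sq, Finset.sum_mul_sum, Finset.mul_sum]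
        refine Finset.sum_congr rfl fun i _ => ?_
        rw [Finset.mul_sum]
        exact Finset.sum_congr rfl fun k _ => by ring
      simp_rw [hsq]
      rw [integral_finsetSum _ fun i _ => integrable_finsetSum _ fun k _ =>
        (hint i k).const_mul _]
      simp only [dotProduct, Matrix.mulVec, Matrix.of_apply, Finset.mul_sum]
      refine Finset.sum_congr rfl fun i _ => ?_
      rw [integral_finsetSum _ fun k _ => (hint i k).const_mul _]
      refine Finset.sum_congr rfl fun k _ => ?_
      rw [integral_const_mul]
      simp
      ring
    rw [this]
    exact integral_nonneg fun x => mul_nonneg (hG x) (sq_nonneg _)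

theorem Matrix.PosSemidef.det_le_exp_trace_sub {N : ℕ} {A : Matrix (Fin N) (Fin N) ℝ}
    (hA : A.PosSemidef) : A.det ≤ Real.exp (A.trace - N) := by
  have hdet : A.det = ∏ i, hA.1.eigenvalues i := by simpa using hA.1.det_eq_prod_eigenvalues
  have htr : A.trace = ∑ i, hA.1.eigenvalues i := by simpa using hA.1.trace_eq_sum_eigenvalues
  have hsum : A.trace - N = ∑ i, (hA.1.eigenvalues i - 1) := by simp [htr]
  rw [hsum, Real.exp_sum, hdet]
  refine Finset.prod_le_prod (fun i _ => hA.eigenvalues_nonneg i) fun i _ => ?_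
  linarith [Real.add_one_le_exp (hA.1.eigenvalues i - 1)]

/-- The monic multiple of the polynomial `W` with `W (cos θ) = sin ((n + 1/2) θ) / sin (θ / 2)`. -/
def halfAnglePoly : ℕ → Polynomial ℝ
  | 0 => 1
  | 1 => Polynomial.X + Polynomial.C (1 / 2)
  | n + 2 => Polynomial.X * halfAnglePoly (n + 1) - Polynomial.C (1 / 4) * halfAnglePoly n

theorem halfAnglePoly_monic_natDegree (n : ℕ) :
    ((halfAnglePoly n).Monic ∧ (halfAnglePoly n).natDegree = n) ∧
      (halfAnglePoly (n + 1)).Monic ∧ (halfAnglePoly (n + 1)).natDegree = n + 1 := by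
  induction n with
  | zero =>
    refine ⟨by simp [halfAnglePoly], ?_⟩
    simp only [halfAnglePoly, zero_add]
    exact ⟨Polynomial.monic_X_add_C _, Polynomial.natDegree_X_add_C _⟩
  | succ n ih =>
    refine ⟨ih.2, ?_⟩
    obtain ⟨⟨h0m, h0d⟩, h1m, h1d⟩ := ih
    have hXm : (Polynomial.X * halfAnglePoly (n + 1)).Monic := Polynomial.monic_X.mul h1m
    have hXd : (Polynomial.X * halfAnglePoly (n + 1)).natDegree = n + 2 := by
      rw [Polynomial.natDegree_X_mul h1m.ne_zero, h1d]
    have hlt : (Polynomial.C (1 / 4 : ℝ) * halfAnglePoly n).natDegree <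
        (Polynomial.X * halfAnglePoly (n + 1)).natDegree := by
      rw [hXd]
      have := Polynomial.natDegree_C_mul_le (1 / 4 : ℝ) (halfAnglePoly n)
      omega
    have hm : (halfAnglePoly (n + 2)).Monic := by
      rw [halfAnglePoly]
      exact hXm.sub_of_left (Polynomial.degree_lt_degree hlt)
    refine ⟨hm, ?_⟩
    change (halfAnglePoly (n + 2)).natDegree = n + 2
    rw [halfAnglePoly, Polynomial.natDegree_sub_eq_left_of_natDegree_lt hlt, hXd]

theorem sin_half_mul_halfAnglePoly (n : ℕ) (θ : ℝ) :
    2 ^ n * ((halfAnglePoly n).eval (cos θ) * sin (θ / 2)) = sin ((n + 1 / 2) * θ) ∧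
      2 ^ (n + 1) * ((halfAnglePoly (n + 1)).eval (cos θ) * sin (θ / 2)) =
        sin ((n + 1 + 1 / 2) * θ) := by
  induction n with
  | zero =>
    refine ⟨by simp [halfAnglePoly]; ring_nf, ?_⟩
    have h3 : ((0 : ℕ) + 1 + 1 / 2 : ℝ) * θ = 3 * (θ / 2) := by push_cast; ring
    have h2 : cos θ = 2 * cos (θ / 2) ^ 2 - 1 := by rw [← cos_two_mul]; ring_nf
    rw [h3, sin_three_mul]
    simp [halfAnglePoly, h2]
    have := sin_sq_add_cos_sq (θ / 2)
    linear_combination (4 * sin (θ / 2)) * this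
  | succ n ih =>
    refine ⟨by push_cast; exact ih.2, ?_⟩
    have hsum : sin (((n + 1 : ℕ) + 1 + 1 / 2 : ℝ) * θ) =
        2 * cos θ * sin ((n + 1 + 1 / 2) * θ) - sin ((n + 1 / 2) * θ) := by
      have e1 : ((n + 1 : ℕ) + 1 + 1 / 2 : ℝ) * θ = (n + 1 + 1 / 2) * θ + θ := by
        push_cast; ring
      have e2 : ((n : ℝ) + 1 / 2) * θ = (n + 1 + 1 / 2) * θ - θ := by ring
      rw [e1, e2, sin_add, sin_sub]
      ring
    rw [hsum, ← ih.1, ← ih.2, halfAnglePoly]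
    simp only [Polynomial.eval_sub, Polynomial.eval_mul, Polynomial.eval_X, Polynomial.eval_C]
    ring

/-- The eigenangle density of `SO(2N+1)` is determinantal. -/
theorem densitySO_eq_det_sq (N : ℕ) (θ : Fin N → ℝ) :
    densitySO N θ = ((2 / π) ^ N / N.factorial) *
      (Matrix.of fun i j : Fin N => sin (((i : ℕ) + 1 / 2 : ℝ) * θ j)).det ^ 2 := by
  have hmat : (Matrix.of fun i j : Fin N => sin (((i : ℕ) + 1 / 2 : ℝ) * θ j)).det =
      (∏ i : Fin N, (2 : ℝ) ^ (i : ℕ)) * ((∏ j, sin (θ j / 2)) *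
        (Matrix.vandermonde fun j => cos (θ j)).det) := by
    rw [Matrix.det_eval_matrixOfPolynomials_eq_det_vandermonde _
      (fun i : Fin N => halfAnglePoly i) (fun i => (halfAnglePoly_monic_natDegree i).1.2)
      (fun i => (halfAnglePoly_monic_natDegree i).1.1), ← Matrix.det_transpose,
      ← Matrix.det_mul_column, ← Matrix.det_mul_row]
    congr 1
    ext i j
    simp only [Matrix.transpose_apply, Matrix.of_apply]
    rw [← (sin_half_mul_halfAnglePoly j (θ i)).1]
    ring
  have hpow : (∏ i : Fin N, (2 : ℝ) ^ (i : ℕ)) ^ 2 * 2 ^ N = 2 ^ (N ^ 2) := by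
    rw [Fin.prod_univ_eq_prod_range (fun i => (2 : ℝ) ^ i) N, Finset.prod_pow_eq_pow_sum,
      ← pow_mul, Finset.sum_range_id_mul_two, ← pow_add]
    congr 1
    cases N with
    | zero => rfl
    | succ k => simp; ring
  rw [hmat, densitySO, ← hpow, Matrix.det_vandermonde]
  simp only [mul_pow, div_pow, Finset.prod_pow]
  field_simp

theorem integral_cos_nat_mul (m : ℕ) (hm : m ≠ 0) : ∫ x in (0 : ℝ)..π, cos (m * x) = 0 := by
  rw [intervalIntegral.integral_comp_mul_left _ (by exact_mod_cast hm)]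
  simp

theorem integral_sin_half_mul_sin_half_of_le (i k : ℕ) (hik : i ≤ k) :
    ∫ x in Set.Icc (0 : ℝ) π, sin ((i + 1 / 2) * x) * sin ((k + 1 / 2) * x) =
      if i = k then π / 2 else 0 := by
  rw [integral_Icc_eq_integral_Ioc, ← intervalIntegral.integral_of_le pi_pos.le]
  obtain ⟨d, rfl⟩ := Nat.exists_eq_add_of_le hik
  have hprod : ∀ x : ℝ, sin ((i + 1 / 2) * x) * sin (((i + d : ℕ) + 1 / 2) * x) =
      (1 / 2) * (cos (d * x) - cos ((2 * i + d + 1 : ℕ) * x)) := by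
    intro x
    have e1 : (d : ℝ) * x = ((i + d : ℕ) + 1 / 2) * x - (i + 1 / 2) * x := by push_cast; ring
    have e2 : ((2 * i + d + 1 : ℕ) : ℝ) * x = ((i + d : ℕ) + 1 / 2) * x + (i + 1 / 2) * x := by
      push_cast; ring
    rw [e1, e2, cos_sub, cos_add]
    ring
  simp_rw [hprod]
  rw [intervalIntegral.integral_const_mul, intervalIntegral.integral_sub
    (Continuous.intervalIntegrable (by fun_prop) _ _)
    (Continuous.intervalIntegrable (by fun_prop) _ _), integral_cos_nat_mul (2 * i + d + 1) (by omega)]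
  rcases Nat.eq_zero_or_pos d with rfl | hd
  · simp
    ring
  · rw [integral_cos_nat_mul d hd.ne', if_neg (by omega)]
    simp

theorem integral_sin_half_mul_sin_half (i k : ℕ) :
    ∫ x in Set.Icc (0 : ℝ) π, sin ((i + 1 / 2) * x) * sin ((k + 1 / 2) * x) =
      if i = k then π / 2 else 0 := by
  rcases le_total i k with h | h
  · exact integral_sin_half_mul_sin_half_of_le i k h
  · have := integral_sin_half_mul_sin_half_of_le k i h
    simp_rw [mul_comm (sin ((i + 1 / 2 : ℝ) * _)), this, eq_comm]

/-- The Dirichlet kernel `1 + 2 ∑_{k=1}^n cos (k x)`. -/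
def dirichletCos (n : ℕ) (x : ℝ) : ℝ := 1 + 2 * ∑ k ∈ Finset.range n, cos ((k + 1 : ℕ) * x)

theorem continuous_dirichletCos (n : ℕ) : Continuous (dirichletCos n) := by
  unfold dirichletCos
  fun_prop

theorem integral_dirichletCos (n : ℕ) : ∫ x in Set.Icc (0 : ℝ) π, dirichletCos n x = π := by
  rw [integral_Icc_eq_integral_Ioc, ← intervalIntegral.integral_of_le pi_pos.le]
  unfold dirichletCos
  rw [intervalIntegral.integral_add (Continuous.intervalIntegrable (by fun_prop) _ _)
    (Continuous.intervalIntegrable (by fun_prop) _ _), intervalIntegral.integral_const_mul,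
    intervalIntegral.integral_finsetSum
      fun k _ => Continuous.intervalIntegrable (by fun_prop) _ _,
    Finset.sum_eq_zero fun k _ => integral_cos_nat_mul (k + 1) k.succ_ne_zero]
  simp

theorem sin_half_mul_dirichletCos (n : ℕ) (x : ℝ) :
    sin (x / 2) * dirichletCos n x = sin ((n + 1 / 2) * x) := by
  induction n with
  | zero => simp [dirichletCos]; ring_nf
  | succ n ih =>
    have hstep : dirichletCos (n + 1) x = dirichletCos n x + 2 * cos ((n + 1 : ℕ) * x) := by
      simp only [dirichletCos, Finset.sum_range_succ]
      ring
    have e1 : ((n + 1 : ℕ) + 1 / 2 : ℝ) * x = (n + 1 : ℕ) * x + x / 2 := by ring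
    have e2 : ((n : ℝ) + 1 / 2) * x = (n + 1 : ℕ) * x - x / 2 := by push_cast; ring
    rw [hstep, mul_add, ih, e1, e2, sin_add, sin_sub]
    ring

theorem sin_half_sq_mul_sum_dirichletCos (n : ℕ) (x : ℝ) :
    sin (x / 2) ^ 2 * ∑ i ∈ Finset.range n, dirichletCos i x = sin (n * x / 2) ^ 2 := by
  induction n with
  | zero => simp
  | succ n ih =>
    rw [Finset.sum_range_succ, mul_add, ih, sq (sin (x / 2)), mul_assoc,
      sin_half_mul_dirichletCos]
    have e1 : ((n + 1 : ℕ) : ℝ) * x / 2 = n * x / 2 + x / 2 := by push_cast; ring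
    have e2 : ((n : ℝ) + 1 / 2) * x = n * x / 2 + (n * x / 2 + x / 2) := by ring
    rw [e1, e2, sin_add (n * x / 2) (n * x / 2 + x / 2), sin_add, cos_add]
    have h2 := sin_sq_add_cos_sq (x / 2)
    linear_combination (-sin (n * x / 2) ^ 2) * h2

/-- Nonnegativity of the Fejér kernel. -/
theorem sum_dirichletCos_nonneg (n : ℕ) {x : ℝ} (hx : x ∈ Set.Icc 0 π) :
    0 ≤ ∑ i ∈ Finset.range n, dirichletCos i x := by
  rcases hx.1.eq_or_lt with rfl | hpos
  · refine Finset.sum_nonneg fun i _ => ?_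
    simp [dirichletCos]
    positivity
  · have hs : 0 < sin (x / 2) := sin_pos_of_pos_of_lt_pi (by linarith) (by linarith [hx.2])
    refine nonneg_of_mul_nonneg_right (a := sin (x / 2) ^ 2) ?_ (by positivity)
    rw [sin_half_sq_mul_sum_dirichletCos]
    positivity

/-- Averages of multiplicative statistics against the eigenangle density are determinants. -/
theorem integral_prod_mul_densitySO (N : ℕ) (G : ℝ → ℝ) (hG : Continuous G) :
    ∫ θ in Set.univ.pi fun _ : Fin N => Set.Icc (0 : ℝ) π, (∏ j, G (θ j)) * densitySO N θ =
      (Matrix.of fun i k : Fin N => ∫ x in Set.Icc (0 : ℝ) π, (2 / π * G x) *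
        (sin (((i : ℕ) + 1 / 2) * x) * sin (((k : ℕ) + 1 / 2) * x))).det := by
  have hand := integral_prod_mul_det_sq (volume.restrict (Set.Icc (0 : ℝ) π))
    (fun (i : Fin N) x => sin (((i : ℕ) + 1 / 2) * x)) (fun x => 2 / π * G x)
    (fun i k => Continuous.integrableOn_Icc (by fun_prop))
  have hfac : (N.factorial : ℝ) ≠ 0 := by positivity
  rw [volume_pi, Measure.restrict_pi_pi, ← mul_right_injective₀ hfac |>.eq_iff]
  rw [← hand, ← integral_const_mul]
  congr 1
  ext θ
  rw [densitySO_eq_det_sq, Finset.prod_mul_distrib]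
  simp only [Finset.prod_const, Finset.card_univ, Fintype.card_fin]
  field_simp

theorem densitySO_nonneg (N : ℕ) (θ : Fin N → ℝ) : 0 ≤ densitySO N θ := by
  rw [densitySO_eq_det_sq]
  positivity

theorem continuous_densitySO (N : ℕ) : Continuous (densitySO N) := by
  unfold densitySO
  fun_prop

theorem integral_densitySO (N : ℕ) :
    ∫ θ in Set.univ.pi fun _ : Fin N => Set.Icc (0 : ℝ) π, densitySO N θ = 1 := by
  have h := integral_prod_mul_densitySO N (fun _ => 1) continuous_const
  simp only [Finset.prod_const_one, one_mul, mul_one] at h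
  refine h.trans ((congrArg Matrix.det ?_).trans Matrix.det_one)
  ext i k
  rw [Matrix.of_apply, integral_const_mul, integral_sin_half_mul_sin_half, Matrix.one_apply]
  simp only [Fin.val_inj]
  split_ifs
  · field_simp
  · simp

theorem integral_exp_sum_mul_densitySO_le (N : ℕ) (f : ℝ → ℝ) (hf : Continuous f) :
    ∫ θ in Set.univ.pi fun _ : Fin N => Set.Icc (0 : ℝ) π,
        exp (∑ j, f (θ j)) * densitySO N θ ≤
      exp (∑ i : Fin N, ∫ x in Set.Icc (0 : ℝ) π,
        (2 / π * (exp (f x) - 1)) * sin (((i : ℕ) + 1 / 2) * x) ^ 2) := by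
  have hdet := integral_prod_mul_densitySO N (fun x => exp (f x)) (by fun_prop)
  simp only [← exp_sum] at hdet
  rw [hdet]
  have hpsd := posSemidef_integral_weight (volume.restrict (Set.Icc (0 : ℝ) π))
    (fun (i : Fin N) x => sin (((i : ℕ) + 1 / 2) * x)) (fun x => 2 / π * exp (f x))
    (fun x => by positivity) (fun i k => Continuous.integrableOn_Icc (by fun_prop))
  refine hpsd.det_le_exp_trace_sub.trans_eq ?_
  rw [exp_eq_exp, Matrix.trace]
  have hcard : (N : ℝ) = ∑ i : Fin N, 1 := by simp
  rw [hcard, ← Finset.sum_sub_distrib]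
  refine Finset.sum_congr rfl fun i _ => ?_
  have hone : ∫ x in Set.Icc (0 : ℝ) π,
      2 / π * (sin (((i : ℕ) + 1 / 2) * x) * sin (((i : ℕ) + 1 / 2) * x)) = 1 := by
    rw [integral_const_mul, integral_sin_half_mul_sin_half, if_pos rfl]
    field_simp
  refine (congrArg (_ - ·) hone.symm).trans ?_
  rw [Matrix.diag_apply, Matrix.of_apply, ← integral_sub (Continuous.integrableOn_Icc (by fun_prop))
      (Continuous.integrableOn_Icc (by fun_prop))]
  congr 1
  ext x
  ring

/-- A multiple of the Poisson kernel; up to a constant, the summand of `hFun`. -/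
def poissonStat (s x : ℝ) : ℝ := (1 - s) / s * ((1 - s ^ 2) / (1 + s ^ 2 - 2 * s * cos x))

theorem poisson_denom_pos {s : ℝ} (h0 : 0 < s) (h1 : s < 1) (x : ℝ) :
    0 < 1 + s ^ 2 - 2 * s * cos x := by
  nlinarith [mul_nonneg h0.le (sub_nonneg.2 (cos_le_one x)), mul_pos (sub_pos.2 h1) (sub_pos.2 h1)]

theorem continuous_poissonStat {s : ℝ} (h0 : 0 < s) (h1 : s < 1) : Continuous (poissonStat s) := by
  unfold poissonStat
  exact continuous_const.mul (continuous_const.div (by fun_prop)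
    fun x => (poisson_denom_pos h0 h1 x).ne')

theorem poissonStat_nonneg {s : ℝ} (h0 : 0 < s) (h1 : s < 1) (x : ℝ) : 0 ≤ poissonStat s x :=
  mul_nonneg (div_nonneg (by linarith) h0.le)
    (div_nonneg (by nlinarith) (poisson_denom_pos h0 h1 x).le)

theorem poissonStat_le_three {s : ℝ} (h0 : 1 / 2 ≤ s) (h1 : s < 1) (x : ℝ) :
    poissonStat s x ≤ 3 := by
  have hs : 0 < s := by linarith
  have hd := poisson_denom_pos hs h1 x
  have hd' : (1 - s) ^ 2 ≤ 1 + s ^ 2 - 2 * s * cos x := by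
    nlinarith [mul_nonneg hs.le (sub_nonneg.2 (cos_le_one x))]
  rw [poissonStat, div_mul_div_comm, div_le_iff₀ (by positivity)]
  calc (1 - s) * (1 - s ^ 2) = (1 + s) * (1 - s) ^ 2 := by ring
    _ ≤ (3 * s) * (1 + s ^ 2 - 2 * s * cos x) := by gcongr; linarith
    _ = _ := by ring

theorem poissonStat_mul_sin_half_sq_le {s : ℝ} (h0 : 1 / 2 ≤ s) (h1 : s < 1) (x : ℝ) :
    poissonStat s x * sin (x / 2) ^ 2 ≤ 2 * (1 - s) ^ 2 := by
  have hs : 0 < s := by linarith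
  have hd := poisson_denom_pos hs h1 x
  have hcos : cos x = 1 - 2 * sin (x / 2) ^ 2 := by
    have h := cos_two_mul (x / 2)
    rw [mul_div_cancel₀ x two_ne_zero] at h
    linarith [sin_sq_add_cos_sq (x / 2)]
  have hd' : 4 * s * sin (x / 2) ^ 2 ≤ 1 + s ^ 2 - 2 * s * cos x := by
    rw [hcos]
    nlinarith [sq_nonneg (1 - s)]
  rw [poissonStat, div_mul_div_comm, div_mul_eq_mul_div, div_le_iff₀ (by positivity)]
  calc (1 - s) * (1 - s ^ 2) * sin (x / 2) ^ 2
      = (1 - s) ^ 2 * ((1 + s) * sin (x / 2) ^ 2) := by ring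
    _ ≤ (1 - s) ^ 2 * ((8 * s ^ 2) * sin (x / 2) ^ 2) := by gcongr; nlinarith
    _ = (2 * (1 - s) ^ 2 * s) * (4 * s * sin (x / 2) ^ 2) := by ring
    _ ≤ (2 * (1 - s) ^ 2 * s) * (1 + s ^ 2 - 2 * s * cos x) := by gcongr
    _ = _ := by ring

theorem exp_sub_one_le_mul_exp {t K : ℝ} (h0 : 0 ≤ t) (hK : t ≤ K) :
    exp t - 1 ≤ t * exp K := by
  have h := mul_le_mul_of_nonneg_left (one_sub_le_exp_neg t) (exp_pos t).le
  rw [← exp_add, add_neg_cancel, exp_zero] at h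
  have := mul_le_mul_of_nonneg_left (exp_le_exp.2 hK) h0
  linarith

theorem sum_integral_exp_poissonStat_le (N : ℕ) {s : ℝ} (h0 : 1 / 2 ≤ s) (h1 : s < 1) :
    ∑ i : Fin N, ∫ x in Set.Icc (0 : ℝ) π,
        (2 / π * (exp (poissonStat s x) - 1)) * sin (((i : ℕ) + 1 / 2) * x) ^ 2 ≤
      4 * exp 3 * ((1 - s) * N) ^ 2 := by
  have hs : 0 < s := by linarith
  have hcont := continuous_poissonStat hs h1
  have hterm : ∀ i : ℕ, ∫ x in Set.Icc (0 : ℝ) π,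
      (2 / π * (exp (poissonStat s x) - 1)) * sin ((i + 1 / 2) * x) ^ 2 ≤
        4 * exp 3 * (1 - s) ^ 2 * (2 * i + 1) := by
    intro i
    calc _ ≤ ∫ x in Set.Icc (0 : ℝ) π, (2 / π * (exp 3 * (2 * (1 - s) ^ 2))) *
            ∑ m ∈ Finset.range (2 * i + 1), dirichletCos m x := by
          refine setIntegral_mono_on (Continuous.integrableOn_Icc (by fun_prop))
            (Continuous.integrableOn_Icc (continuous_const.mul
              (continuous_finsetSum _ fun m _ => continuous_dirichletCos m)))
            measurableSet_Icc fun x hx => ?_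
          have hfejer := sin_half_sq_mul_sum_dirichletCos (2 * i + 1) x
          have harg : ((2 * i + 1 : ℕ) : ℝ) * x / 2 = (i + 1 / 2) * x := by push_cast; ring
          rw [harg] at hfejer
          have hnn := sum_dirichletCos_nonneg (2 * i + 1) hx
          have hexp := exp_sub_one_le_mul_exp (poissonStat_nonneg hs h1 x)
            (poissonStat_le_three h0 h1 x)
          have hloc := poissonStat_mul_sin_half_sq_le h0 h1 x
          rw [mul_assoc, mul_assoc]
          gcongr 2 / π * ?_
          calc (exp (poissonStat s x) - 1) * sin ((i + 1 / 2) * x) ^ 2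
              ≤ (poissonStat s x * exp 3) * sin ((i + 1 / 2) * x) ^ 2 := by gcongr
            _ = exp 3 * (poissonStat s x * sin (x / 2) ^ 2) *
                ∑ m ∈ Finset.range (2 * i + 1), dirichletCos m x := by rw [← hfejer]; ring
            _ ≤ _ := by gcongr
      _ = _ := by
          rw [integral_const_mul, integral_finsetSum _ fun m _ =>
            (continuous_dirichletCos m).integrableOn_Icc]
          simp only [integral_dirichletCos, Finset.sum_const, Finset.card_range, nsmul_eq_mul]
          field_simp
          push_cast
          ring
  have hodd : ∑ i ∈ Finset.range N, (2 * (i : ℝ) + 1) = N ^ 2 := by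
    induction N with
    | zero => simp
    | succ n ih => rw [Finset.sum_range_succ, ih]; push_cast; ring
  refine (Finset.sum_le_sum fun (i : Fin N) _ => hterm i).trans_eq ?_
  rw [← Finset.mul_sum, Fin.sum_univ_eq_sum_range (fun i => 2 * (i : ℝ) + 1) N, hodd]
  ring

theorem integrableOn_mul_densitySO {N : ℕ} {F : (Fin N → ℝ) → ℝ} (hF : Continuous F) :
    IntegrableOn (fun θ => F θ * densitySO N θ)
      (Set.univ.pi fun _ : Fin N => Set.Icc (0 : ℝ) π) :=
  (hF.mul (continuous_densitySO N)).continuousOn.integrableOn_compact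
    (isCompact_univ_pi fun _ => isCompact_Icc)

theorem integrableOn_densitySO (N : ℕ) :
    IntegrableOn (densitySO N) (Set.univ.pi fun _ : Fin N => Set.Icc (0 : ℝ) π) := by
  simpa using integrableOn_mul_densitySO (N := N) (F := fun _ => 1) continuous_const

/-- All moments of the Poisson statistic are quadratically small. -/
theorem integral_sum_poissonStat_pow_le (n : ℕ) (hn : n ≠ 0) (N : ℕ) {s a : ℝ} (h0 : 1 / 2 ≤ s)
    (h1 : s < 1) (ha : (1 - s) * N ≤ a) (ha1 : a ≤ 1) :
    ∫ θ in Set.univ.pi fun _ : Fin N => Set.Icc (0 : ℝ) π,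
        (∑ j, poissonStat s (θ j)) ^ n * densitySO N θ ≤
      n.factorial * (4 * exp 3 * exp (4 * exp 3)) * a ^ 2 := by
  have hs : 0 < s := by linarith
  have hcont := continuous_poissonStat hs h1
  have hpos : 0 ≤ (1 - s) * (N : ℝ) := mul_nonneg (by linarith) (Nat.cast_nonneg N)
  have hexp : ∫ θ in Set.univ.pi fun _ : Fin N => Set.Icc (0 : ℝ) π,
      exp (∑ j, poissonStat s (θ j)) * densitySO N θ ≤ exp (4 * exp 3 * a ^ 2) := by
    refine (integral_exp_sum_mul_densitySO_le N _ hcont).trans (exp_le_exp.2 ?_)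
    refine (sum_integral_exp_poissonStat_le N h0 h1).trans ?_
    gcongr
  have hsmall : exp (4 * exp 3 * a ^ 2) - 1 ≤ 4 * exp 3 * a ^ 2 * exp (4 * exp 3) := by
    refine exp_sub_one_le_mul_exp (by positivity) ?_
    have : a ^ 2 ≤ 1 := pow_le_one₀ (hpos.trans ha) ha1
    nlinarith [exp_pos 3]
  have hpoint : ∀ t : ℝ, 0 ≤ t → t ^ n ≤ n.factorial * (exp t - 1) := by
    intro t ht
    have h := sum_le_exp_of_nonneg ht (n + 1)
    rw [Finset.sum_range_succ] at h
    have hfirst : (1 : ℝ) ≤ ∑ i ∈ Finset.range n, t ^ i / i.factorial := by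
      have := Finset.single_le_sum (f := fun i => t ^ i / (i.factorial : ℝ))
        (fun i _ => by positivity) (Finset.mem_range.2 (Nat.pos_of_ne_zero hn))
      simpa using this
    rw [mul_comm, ← div_le_iff₀ (by positivity)]
    linarith
  calc _ ≤ ∫ θ in Set.univ.pi fun _ : Fin N => Set.Icc (0 : ℝ) π,
          (n.factorial * (exp (∑ j, poissonStat s (θ j)) - 1)) * densitySO N θ := by
        refine integral_mono (integrableOn_mul_densitySO (by fun_prop))
          (integrableOn_mul_densitySO (by fun_prop)) fun θ => ?_
        exact mul_le_mul_of_nonneg_right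
          (hpoint _ (Finset.sum_nonneg fun j _ => poissonStat_nonneg hs h1 _))
          (densitySO_nonneg N θ)
    _ = n.factorial * ((∫ θ in Set.univ.pi fun _ : Fin N => Set.Icc (0 : ℝ) π,
          exp (∑ j, poissonStat s (θ j)) * densitySO N θ) - 1) := by
        simp_rw [mul_assoc, sub_mul, one_mul]
        rw [integral_const_mul, integral_sub (integrableOn_mul_densitySO (by fun_prop))
          (integrableOn_densitySO N), integral_densitySO]
    _ ≤ n.factorial * (4 * exp 3 * a ^ 2 * exp (4 * exp 3)) := by
        gcongr
        linarith
    _ = _ := by ring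

theorem hFun_eq_integral_poissonStat (n N : ℕ) {s : ℝ} (h0 : 0 < s) (h1 : s < 1) :
    hFun n s N = ∫ θ in Set.univ.pi fun _ : Fin N => Set.Icc (0 : ℝ) π,
      (∑ j, poissonStat s (θ j) - (1 - s) / s * N) ^ n * densitySO N θ := by
  have hterm : ∀ x, (s - 1) * ((2 * s - 2 * cos x) / (1 + s ^ 2 - 2 * s * cos x)) =
      poissonStat s x - (1 - s) / s := by
    intro x
    have hd := (poisson_denom_pos h0 h1 x).ne'
    rw [poissonStat, mul_div_assoc', div_mul_div_comm,
      div_sub_div _ _ (mul_ne_zero h0.ne' hd) h0.ne',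
      div_eq_div_iff hd (mul_ne_zero (mul_ne_zero h0.ne' hd) h0.ne')]
    ring
  simp only [hFun, Finset.mul_sum, hterm, Finset.sum_sub_distrib]
  simp [mul_comm]

/-- Asymptotics of `h(n, e^{-a_N/N}, N)` for fixed `n`:  it tends to `1` for `n = 0`, to
`-a_N` for `n = 1`, and to `0` otherwise, with error `O(a_N/N) + O(a_N²)`. -/
theorem hFun_asymptotics
    (n : ℕ) (a : ℕ → ℝ) (hapos : ∀ N : ℕ, 1 ≤ N → 0 < a N)
    (halim : Tendsto a atTop (nhds 0)) :
    ∃ C : ℝ, 0 < C ∧ ∃ N₀ : ℕ, ∀ N : ℕ, N₀ ≤ N →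
      |hFun n (Real.exp (-(a N) / N)) N -
          (if n = 0 then 1 else if n = 1 then -(a N) else 0)| ≤
        C * (a N / N + a N ^ 2) := by
  set K : ℝ := n.factorial * (4 * exp 3 * exp (4 * exp 3)) with hK
  have hKpos : 0 < K := by positivity
  obtain ⟨N₁, hN₁⟩ := eventually_atTop.1
    (halim.eventually (ge_mem_nhds (show (0 : ℝ) < 1 / 2 by norm_num)))
  refine ⟨2 ^ n * (K + 2 ^ n), by positivity, max 1 N₁, fun N hN => ?_⟩
  have hN1 : 1 ≤ N := (le_max_left _ _).trans hN
  have hapos := hapos N hN1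
  have hahalf := hN₁ N ((le_max_right _ _).trans hN)
  generalize a N = α at hapos hahalf ⊢
  have hNpos : (0 : ℝ) < N := by exact_mod_cast hN1
  have hN1' : (1 : ℝ) ≤ N := by exact_mod_cast hN1
  set x : ℝ := α / N with hx
  have hxN : x * N = α := div_mul_cancel₀ _ hNpos.ne'
  have hxpos : 0 < x := div_pos hapos hNpos
  have hxle : x ≤ α := div_le_self hapos.le hN1'
  rw [neg_div, ← hx]
  set s : ℝ := exp (-x) with hs
  have hs1 : s < 1 := exp_lt_one_iff.2 (by linarith)
  have hsge : 1 - x ≤ s := one_sub_le_exp_neg x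
  have hs2 : 1 / 2 ≤ s := by linarith
  have hs0 : 0 < s := exp_pos _
  have hcont := continuous_poissonStat hs0 hs1
  have hbd : (1 - s) * N ≤ α := by
    rw [← hxN]
    gcongr
    linarith
  suffices hmain : |hFun n s N - (if n = 0 then 1 else if n = 1 then -α else 0)| ≤
      2 ^ n * (K + 2 ^ n) * α ^ 2 by
    refine hmain.trans ?_
    gcongr
    linarith
  set b : ℝ := (1 - s) / s * N with hb
  have hb_eq : (1 - s) / s = exp x - 1 := by
    rw [hs, exp_neg]
    field_simp
  have hb_ge : α ≤ b := by
    rw [hb, hb_eq, ← hxN]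
    gcongr
    linarith [add_one_le_exp x]
  have hb_le : b ≤ α + α ^ 2 := by
    have hquad : exp x - 1 - x ≤ x ^ 2 :=
      (le_abs_self _).trans (abs_exp_sub_one_sub_id_le (by rw [abs_of_pos hxpos]; linarith))
    calc b = (exp x - 1) * N := by rw [hb, hb_eq]
      _ ≤ (x + x ^ 2) * N := by gcongr; linarith
      _ = α + x * α := by rw [← hxN]; ring
      _ ≤ α + α ^ 2 := by nlinarith
  rw [hFun_eq_integral_poissonStat n N hs0 hs1]
  rcases Nat.eq_zero_or_pos n with rfl | hnpos
  · simp only [pow_zero, one_mul, integral_densitySO, if_true, sub_self, abs_zero]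
    positivity
  have hmom := integral_sum_poissonStat_pow_le n hnpos.ne' N hs2 hs1 hbd (by linarith)
  rw [← hK] at hmom
  rw [if_neg hnpos.ne']
  rcases eq_or_ne n 1 with rfl | hn1
  · simp only [pow_one, if_true] at hmom ⊢
    have hsplit : ∫ θ in Set.univ.pi fun _ : Fin N => Set.Icc (0 : ℝ) π,
        (∑ j, poissonStat s (θ j) - b) * densitySO N θ =
        (∫ θ in Set.univ.pi fun _ : Fin N => Set.Icc (0 : ℝ) π,
          (∑ j, poissonStat s (θ j)) * densitySO N θ) - b := by
      simp_rw [sub_mul]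
      rw [integral_sub (integrableOn_mul_densitySO (by fun_prop)) ((integrableOn_densitySO N).const_mul _),
        integral_const_mul, integral_densitySO, mul_one]
    have hnn : 0 ≤ ∫ θ in Set.univ.pi fun _ : Fin N => Set.Icc (0 : ℝ) π,
        (∑ j, poissonStat s (θ j)) * densitySO N θ :=
      integral_nonneg fun θ => mul_nonneg
        (Finset.sum_nonneg fun j _ => poissonStat_nonneg hs0 hs1 _) (densitySO_nonneg N θ)
    have hα2 : 0 ≤ α ^ 2 := sq_nonneg α
    rw [hsplit, abs_le]
    constructor <;> nlinarith [mul_nonneg hKpos.le hα2]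
  · rw [if_neg hn1, sub_zero]
    have hbpow : b ^ n ≤ 2 ^ n * α ^ 2 := by
      calc b ^ n ≤ (2 * α) ^ n := by
            gcongr
            nlinarith
        _ = 2 ^ n * α ^ n := mul_pow _ _ _
        _ ≤ 2 ^ n * α ^ 2 := by
            gcongr 2 ^ n * ?_
            exact pow_le_pow_of_le_one hapos.le (by linarith) (by omega)
    have hpoint : ∀ t : ℝ, 0 ≤ t → |(t - b) ^ n| ≤ 2 ^ n * (t ^ n + b ^ n) := by
      intro t ht
      have hb0 : 0 ≤ b := hapos.le.trans hb_ge
      rw [abs_pow]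
      calc |t - b| ^ n ≤ (t + b) ^ n := by
            gcongr
            rw [abs_le]
            constructor <;> linarith
        _ ≤ 2 ^ (n - 1) * (t ^ n + b ^ n) := add_pow_le ht hb0 n
        _ ≤ 2 ^ n * (t ^ n + b ^ n) := by
            gcongr
            · norm_num
            · omega
    refine (abs_integral_le_integral_abs).trans ?_
    calc _ ≤ ∫ θ in Set.univ.pi fun _ : Fin N => Set.Icc (0 : ℝ) π,
            (2 ^ n * ((∑ j, poissonStat s (θ j)) ^ n + b ^ n)) * densitySO N θ := by
          refine integral_mono (integrableOn_mul_densitySO (by fun_prop)).abs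
            (integrableOn_mul_densitySO (by fun_prop)) fun θ => ?_
          beta_reduce
          rw [abs_mul, abs_of_nonneg (densitySO_nonneg N θ)]
          exact mul_le_mul_of_nonneg_right
            (hpoint _ (Finset.sum_nonneg fun j _ => poissonStat_nonneg hs0 hs1 _))
            (densitySO_nonneg N θ)
      _ = 2 ^ n * ((∫ θ in Set.univ.pi fun _ : Fin N => Set.Icc (0 : ℝ) π,
            (∑ j, poissonStat s (θ j)) ^ n * densitySO N θ) + b ^ n) := by
          simp_rw [mul_assoc, add_mul]
          rw [integral_const_mul, integral_add (integrableOn_mul_densitySO (by fun_prop))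
            ((integrableOn_densitySO N).const_mul _), integral_const_mul, integral_densitySO, mul_one]
      _ ≤ 2 ^ n * (K * α ^ 2 + 2 ^ n * α ^ 2) := by gcongr
      _ = _ := by ring
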